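/- Let t ≥ 1, let f ∈ ∑_{1≤i,j≤t} A(i) ⊗ A(j), let n > 2t be a natural number, and set H' = ∑_{0≤i,j≤t} A(i) ⊗ A(j). Then there exists a homogeneous K-subspace T ⊆ A(n) ⊗ (∑_{i : (n−t)/(2t) ≤ i ≤ 2tn+t} A(i)) with dim_K T < 2^{4t+3}·n³·t² such that, for every integer m > n, H'·f^m ⊆ T·H'·f^{m−n}·(A ⊗_K A); in particular f^m ∈ T·H'·f^{m−n}·(A ⊗_K A). -/

import Mathlib

open TensorProduct

noncomputable section

/-- The free associative unital `K`-algebra on two generators `x, y`. -/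
abbrev FA (K : Type) [Field K] : Type := FreeAlgebra K (Fin 2)

/-- `gp K n` is `A(n)`, the span of the words of length `n` in the two generators. -/
def gp (K : Type) [Field K] (n : ℕ) : Submodule K (FA K) :=
  Submodule.span K {a : FA K | ∃ w : List (Fin 2), w.length = n ∧ a = (w.map (FreeAlgebra.ι K)).prod}

/-- The canonical image of `U ⊗[K] V` inside `A ⊗[K] A`. -/
def tp (K : Type) [Field K] (U V : Submodule K (FA K)) : Submodule K (FA K ⊗[K] FA K) :=
  Submodule.map₂ (TensorProduct.mk K (FA K) (FA K)) U V

/-- `∑_{i : (n−t)/(2t) ≤ i ≤ 2tn+t} A(i)`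
(the condition `(n−t)/(2t) ≤ i` is encoded as `n ≤ 2ti + t`). -/
def midGp' (K : Type) [Field K] (t n : ℕ) : Submodule K (FA K) :=
  ⨆ i ∈ {i : ℕ | n ≤ 2 * t * i + t ∧ i ≤ 2 * t * n + t}, gp K i

/-- `∑_{0 ≤ i, j ≤ t} A(i) ⊗ A(j)`. -/
def Hsp (K : Type) [Field K] (t : ℕ) : Submodule K (FA K ⊗[K] FA K) :=
  ⨆ i ∈ Finset.Iic t, ⨆ j ∈ Finset.Iic t, tp K (gp K i) (gp K j)

/-- A subspace of `A ⊗[K] A` is homogeneous if it is spanned by elements lying in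
subspaces of the form `A(i) ⊗ A(j)`. -/
def IsHomog (K : Type) [Field K] (S : Submodule K (FA K ⊗[K] FA K)) : Prop :=
  ∃ B : Set (FA K ⊗[K] FA K),
    (∀ x ∈ B, ∃ i j : ℕ, x ∈ tp K (gp K i) (gp K j)) ∧ S = Submodule.span K B

section CrossingExpansion

variable {R : Type*} [Ring R]

/-- The part of `(∑ i, c i) ^ k` of weight `s`, where `c i` has weight `i`. -/
def powPart (c : ℕ → R) : ℕ → ℕ → R
  | 0, s => if s = 0 then 1 else 0
  | k + 1, s => ∑ j ∈ Finset.range (s + 1), powPart c k j * c (s - j)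

theorem powPart_eq_zero_of_lt {c : ℕ → R} (h0 : c 0 = 0) {k s : ℕ} (h : s < k) :
    powPart c k s = 0 := by
  induction k generalizing s with
  | zero => omega
  | succ k ih =>
    refine Finset.sum_eq_zero fun j hj => ?_
    rw [Finset.mem_range] at hj
    rcases lt_or_ge j k with hjk | hjk
    · rw [ih hjk, zero_mul]
    · rw [show s - j = 0 by omega, h0, mul_zero]

theorem powPart_eq_zero_of_gt {c : ℕ → R} {t : ℕ} (hc : ∀ i, t < i → c i = 0) {k s : ℕ}
    (h : t * k < s) : powPart c k s = 0 := by
  induction k generalizing s with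
  | zero => simp [powPart, show s ≠ 0 by omega]
  | succ k ih =>
    refine Finset.sum_eq_zero fun j _ => ?_
    rw [mul_add] at h
    rcases lt_or_ge (t * k) j with hjk | hjk
    · rw [ih hjk, zero_mul]
    · rw [hc (s - j) (by omega), mul_zero]

theorem sum_powPart_mul {c : ℕ → R} {t : ℕ} (hc : ∀ i, t < i → c i = 0) (N k : ℕ) :
    (∑ s ∈ Finset.range N, powPart c k s) * ∑ i ∈ Finset.range (t + 1), c i =
      (∑ s ∈ Finset.range N, powPart c (k + 1) s) +
        ∑ s ∈ Finset.range N, ∑ i ∈ Finset.Ico (N - s) (t + 1), powPart c k s * c i := by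
  have key (M : ℕ) : ∑ i ∈ Finset.range (t + 1), c i =
      ∑ i ∈ Finset.range M, c i + ∑ i ∈ Finset.Ico M (t + 1), c i := by
    rcases le_total M (t + 1) with h | h
    · rw [Finset.sum_range_add_sum_Ico _ h]
    · rw [Finset.Ico_eq_empty_of_le h, Finset.sum_empty, add_zero]
      refine Finset.sum_subset (Finset.range_mono h) fun i _ hi => hc i ?_
      rw [Finset.mem_range] at hi
      omega
  simp only [powPart]
  rw [Finset.sum_range_diag_flip N fun j i => powPart c k j * c i, ← Finset.sum_add_distrib,
    Finset.sum_mul]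
  refine Finset.sum_congr rfl fun s _ => ?_
  rw [key (N - s), mul_add, Finset.mul_sum, Finset.mul_sum]

/-- Membership of `h * (∑ i, c i) ^ m` can be checked on the products in which the total weight
of the first factors reaches `N`. -/
theorem mul_pow_mem_of_crossing {c : ℕ → R} (h0 : c 0 = 0) {t : ℕ} (hc : ∀ i, t < i → c i = 0)
    {f : R} (hf : f = ∑ i ∈ Finset.range (t + 1), c i) (X : AddSubmonoid R) (h : R) {N m : ℕ}
    (hN : 0 < N) (hNm : N ≤ m)
    (hX : ∀ k < N, ∀ s < N, ∀ i, N - s ≤ i → i ≤ t →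
      h * powPart c k s * c i * f ^ (m - (k + 1)) ∈ X) :
    h * f ^ m ∈ X := by
  have key : ∀ k ≤ N, ∃ x ∈ X,
      h * f ^ m = h * (∑ s ∈ Finset.range N, powPart c k s) * f ^ (m - k) + x := by
    intro k
    induction k with
    | zero =>
      refine fun _ => ⟨0, X.zero_mem, ?_⟩
      simp [powPart, hN.ne']
    | succ k ih =>
      intro hk
      obtain ⟨x, hx, e⟩ := ih (by omega)
      refine ⟨h * (∑ s ∈ Finset.range N, ∑ i ∈ Finset.Ico (N - s) (t + 1),
        powPart c k s * c i) * f ^ (m - (k + 1)) + x, X.add_mem ?_ hx, ?_⟩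
      · simp only [Finset.mul_sum, Finset.sum_mul]
        refine X.sum_mem fun s hs => X.sum_mem fun i hi => ?_
        rw [Finset.mem_range] at hs
        rw [Finset.mem_Ico] at hi
        rw [← mul_assoc]
        exact hX k (by omega) s hs i hi.1 (by omega)
      · rw [e, show m - k = (m - (k + 1)) + 1 by omega, pow_succ', ← add_assoc, ← add_mul,
          ← mul_add, ← sum_powPart_mul hc, ← hf]
        simp only [mul_assoc]
  obtain ⟨x, hx, e⟩ := key N le_rfl
  rw [Finset.sum_eq_zero fun s hs => powPart_eq_zero_of_lt h0 (Finset.mem_range.1 hs)] at e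
  rw [e]
  simpa using hx

end CrossingExpansion

theorem mul_mem_mul_of_span_singleton_mul_le {K R : Type*} [CommSemiring K] [Semiring R]
    [Algebra K R] {U V X Y : Submodule K R} {a c : R} (hU : Submodule.span K {a} * U ≤ X)
    (hV : V ≤ Y) (hc : c ∈ U * V) : a * c ∈ X * Y := by
  have := Submodule.mul_mem_mul (Submodule.mem_span_singleton_self (R := K) a) hc
  rw [← mul_assoc] at this
  exact mul_le_mul' hU hV this

section Grading

variable {K : Type} [Field K]

/-- The word with letters `w`, as an element of the free algebra. -/
def wordProd (K : Type) [Field K] (w : List (Fin 2)) : FA K := (w.map (FreeAlgebra.ι K)).prod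

theorem wordProd_mem_gp (w : List (Fin 2)) : wordProd K w ∈ gp K w.length :=
  Submodule.subset_span ⟨w, rfl, rfl⟩

theorem one_mem_gp_zero : (1 : FA K) ∈ gp K 0 := wordProd_mem_gp []

theorem gp_mul_gp (a b : ℕ) : gp K a * gp K b = gp K (a + b) := by
  refine le_antisymm ?_ (Submodule.span_le.2 ?_)
  · rw [gp, gp, Submodule.span_mul_span, Submodule.span_le]
    rintro _ ⟨_, ⟨v, rfl, rfl⟩, _, ⟨w, rfl, rfl⟩, rfl⟩
    exact Submodule.subset_span ⟨v ++ w, by simp, by simp⟩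
  · rintro _ ⟨w, hw, rfl⟩
    rw [← List.take_append_drop a w, List.map_append, List.prod_append]
    refine Submodule.mul_mem_mul (Submodule.subset_span ⟨_, ?_, rfl⟩)
      (Submodule.subset_span ⟨_, ?_, rfl⟩)
    · simp [hw]
    · simp [hw]

theorem tp_mono {U U' V V' : Submodule K (FA K)} (hU : U ≤ U') (hV : V ≤ V') :
    tp K U V ≤ tp K U' V' :=
  Submodule.map₂_le_map₂ hU hV

theorem tmul_mem_tp {U V : Submodule K (FA K)} {a b : FA K} (ha : a ∈ U) (hb : b ∈ V) :
    a ⊗ₜ[K] b ∈ tp K U V :=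
  Submodule.apply_mem_map₂ _ ha hb

theorem tp_eq_span (U V : Submodule K (FA K)) :
    tp K U V = Submodule.span K (Set.image2 (fun a b => a ⊗ₜ[K] b) U V) :=
  Submodule.map₂_eq_span_image2 _ _ _

theorem tp_mul_tp_le (U V U' V' : Submodule K (FA K)) :
    tp K U V * tp K U' V' ≤ tp K (U * U') (V * V') := by
  rw [tp_eq_span, tp_eq_span, Submodule.span_mul_span, Submodule.span_le]
  rintro _ ⟨_, ⟨a, ha, b, hb, rfl⟩, _, ⟨a', ha', b', hb', rfl⟩, rfl⟩
  simp only [Algebra.TensorProduct.tmul_mul_tmul]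
  exact tmul_mem_tp (Submodule.mul_mem_mul ha ha') (Submodule.mul_mem_mul hb hb')

theorem tp_mul_le (U U' V : Submodule K (FA K)) : tp K (U * U') V ≤ tp K U 1 * tp K U' V := by
  refine Submodule.map₂_le.2 fun a ha v hv => ?_
  induction ha using Submodule.mul_induction_on' with
  | mem_mul_mem x hx y hy =>
    have := Submodule.mul_mem_mul (tmul_mem_tp hx (Submodule.one_le.1 le_rfl))
      (tmul_mem_tp hy hv)
    rwa [Algebra.TensorProduct.tmul_mul_tmul, one_mul] at this
  | add x _ y _ hx hy =>
    rw [map_add, LinearMap.add_apply]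
    exact add_mem hx hy

/-- The sum of the `gp K r` with `a ≤ r ≤ b`. -/
def gpIcc (K : Type) [Field K] (a b : ℕ) : Submodule K (FA K) := ⨆ r ∈ Finset.Icc a b, gp K r

theorem gp_le_gpIcc {a b r : ℕ} (ha : a ≤ r) (hb : r ≤ b) : gp K r ≤ gpIcc K a b :=
  le_iSup₂_of_le r (Finset.mem_Icc.2 ⟨ha, hb⟩) le_rfl

theorem gpIcc_mul_gpIcc_le (a b a' b' : ℕ) :
    gpIcc K a b * gpIcc K a' b' ≤ gpIcc K (a + a') (b + b') := by
  simp only [gpIcc, Submodule.iSup_mul, Submodule.mul_iSup, gp_mul_gp]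
  refine iSup₂_le fun i hi => iSup₂_le fun j hj => ?_
  rw [Finset.mem_Icc] at hi hj
  exact gp_le_gpIcc (by omega) (by omega)

theorem tp_gpIcc (U : Submodule K (FA K)) (a b : ℕ) :
    tp K U (gpIcc K a b) = ⨆ r ∈ Finset.Icc a b, tp K U (gp K r) := by
  simp only [tp, gpIcc, Submodule.map₂_iSup_right]

theorem tp_gp_le_Hsp {t i j : ℕ} (hi : i ≤ t) (hj : j ≤ t) : tp K (gp K i) (gp K j) ≤ Hsp K t :=
  le_iSup₂_of_le i (Finset.mem_Iic.2 hi) (le_iSup₂_of_le j (Finset.mem_Iic.2 hj) le_rfl)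

theorem tp_gpIcc_le_Hsp {t i a b : ℕ} (hi : i ≤ t) (hb : b ≤ t) :
    tp K (gp K i) (gpIcc K a b) ≤ Hsp K t := by
  rw [tp_gpIcc]
  refine iSup₂_le fun r hr => tp_gp_le_Hsp hi ?_
  rw [Finset.mem_Icc] at hr
  omega

theorem tp_gp_eq_span (i j : ℕ) : tp K (gp K i) (gp K j) =
    Submodule.span K {x | ∃ u v : List (Fin 2), u.length = i ∧ v.length = j ∧
      x = wordProd K u ⊗ₜ[K] wordProd K v} := by
  rw [tp, gp, gp, Submodule.map₂_span_span]
  congr 1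
  ext x
  constructor
  · rintro ⟨_, ⟨u, hu, rfl⟩, _, ⟨v, hv, rfl⟩, rfl⟩
    exact ⟨u, v, hu, hv, rfl⟩
  · rintro ⟨u, v, hu, hv, rfl⟩
    exact ⟨_, ⟨u, hu, rfl⟩, _, ⟨v, hv, rfl⟩, rfl⟩

theorem tp_gp_one_le_span (i : ℕ) : tp K (gp K i) 1 ≤
    Submodule.span K {x | ∃ w : List (Fin 2), w.length = i ∧ x = wordProd K w ⊗ₜ[K] 1} := by
  rw [tp, gp, Submodule.one_eq_span, Submodule.map₂_span_span]
  refine Submodule.span_mono ?_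
  rintro _ ⟨_, ⟨u, hu, rfl⟩, _, rfl, rfl⟩
  exact ⟨u, hu, rfl⟩

theorem exists_left_components {t : ℕ} {f : FA K ⊗[K] FA K}
    (hf : f ∈ ⨆ i ∈ Finset.Icc 1 t, ⨆ j ∈ Finset.Icc 1 t, tp K (gp K i) (gp K j)) :
    ∃ c : ℕ → FA K ⊗[K] FA K, c 0 = 0 ∧ (∀ i, t < i → c i = 0) ∧
      (∀ i, c i ∈ tp K (gp K i) (gpIcc K 1 t)) ∧ f = ∑ i ∈ Finset.range (t + 1), c i := by
  simp only [← tp_gpIcc] at hf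
  obtain ⟨c, hc⟩ := (Submodule.mem_iSup_finset_iff_exists_sum _ _).1 hf
  refine ⟨fun i => if i ∈ Finset.Icc 1 t then c i else 0, by simp, fun i hi => ?_, fun i => ?_, ?_⟩
  · exact if_neg (by simp [hi])
  · dsimp only
    split_ifs
    · exact (c i).2
    · exact zero_mem _
  · rw [← hc, ← Finset.sum_filter]
    refine Finset.sum_congr ?_ fun _ _ => rfl
    ext i
    simp only [Finset.mem_filter, Finset.mem_range, Finset.mem_Icc]
    omega

theorem powPart_mem {c : ℕ → FA K ⊗[K] FA K} {t : ℕ}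
    (hc : ∀ i, c i ∈ tp K (gp K i) (gpIcc K 1 t)) (k s : ℕ) :
    powPart c k s ∈ tp K (gp K s) (gpIcc K k (t * k)) := by
  induction k generalizing s with
  | zero =>
    rw [powPart]
    split_ifs with h
    · subst h
      exact tmul_mem_tp one_mem_gp_zero (gp_le_gpIcc le_rfl le_rfl one_mem_gp_zero)
    · exact zero_mem _
  | succ k ih =>
    refine sum_mem fun j hj => ?_
    rw [Finset.mem_range] at hj
    have := tp_mul_tp_le _ _ _ _ (Submodule.mul_mem_mul (ih j) (hc (s - j)))
    rw [gp_mul_gp, show j + (s - j) = s by omega] at this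
    exact tp_mono le_rfl (gpIcc_mul_gpIcc_le _ _ _ _) this

theorem exists_powPart_components {c : ℕ → FA K ⊗[K] FA K} {t : ℕ}
    (hc : ∀ i, c i ∈ tp K (gp K i) (gpIcc K 1 t)) :
    ∃ p : ℕ → ℕ → ℕ → FA K ⊗[K] FA K, (∀ k s r, p k s r ∈ tp K (gp K s) (gp K r)) ∧
      ∀ k s, powPart c k s = ∑ r ∈ Finset.Icc k (t * k), p k s r := by
  have (k s : ℕ) : ∃ q : (r : ℕ) → tp K (gp K s) (gp K r),
      ∑ r ∈ Finset.Icc k (t * k), (q r : FA K ⊗[K] FA K) = powPart c k s := by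
    have := powPart_mem hc k s
    rw [tp_gpIcc] at this
    exact (Submodule.mem_iSup_finset_iff_exists_sum _ _).1 this
  choose q hq using this
  exact ⟨fun k s r => q k s r, fun k s r => (q k s r).2, fun k s => (hq k s).symm⟩

end Grading

section ShortWords

/-- The words of length at most `t`. -/
abbrev ShortWord (t : ℕ) : Type := Σ l : Fin (t + 1), Fin l → Fin 2

theorem card_shortWord_lt (t : ℕ) : Fintype.card (ShortWord t) < 2 ^ (t + 1) := by
  have := Nat.geomSum_eq (le_refl 2) (t + 1)
  have h2 := Nat.one_le_two_pow (n := t + 1)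
  simp only [Fintype.card_sigma, Fintype.card_fun, Fintype.card_fin,
    Fin.sum_univ_eq_sum_range (fun l => 2 ^ l) (t + 1)]
  omega

/-- The list of letters of a short word. -/
def ShortWord.toList {t : ℕ} (w : ShortWord t) : List (Fin 2) := List.ofFn w.2

theorem exists_shortWord {t : ℕ} (w : List (Fin 2)) (hw : w.length ≤ t) :
    ∃ w' : ShortWord t, w'.toList = w :=
  ⟨⟨⟨w.length, by omega⟩, w.get⟩, List.ofFn_get w⟩

end ShortWords

section CrossingSpace

variable {K : Type} [Field K]

/-- The index set for the products spanning `crossingSpan`. -/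
abbrev CrossingIndex (t n : ℕ) : Type :=
  ShortWord t × ShortWord t × Fin n × ShortWord t × Fin (t * n + 1)

/-- The products `(u ⊗ v) * p k s r * (w ⊗ 1)` with `u`, `v`, `w` short words and
`s = n - |u| - |w|`. -/
def crossingElem (p : ℕ → ℕ → ℕ → FA K ⊗[K] FA K) {t n : ℕ} (x : CrossingIndex t n) :
    FA K ⊗[K] FA K :=
  match x with
  | (u, v, k, w, r) => wordProd K u.toList ⊗ₜ[K] wordProd K v.toList *
      p k (n - u.toList.length - w.toList.length) r * wordProd K w.toList ⊗ₜ[K] 1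

/-- The span of the crossing elements that lie in the bidegrees allowed by `midGp'`. -/
def crossingSpan (p : ℕ → ℕ → ℕ → FA K ⊗[K] FA K) (t n : ℕ) : Submodule K (FA K ⊗[K] FA K) :=
  Submodule.span K {x | x ∈ Set.range (crossingElem p (t := t) (n := n)) ∧
    ∃ j, (n ≤ 2 * t * j + t ∧ j ≤ 2 * t * n + t) ∧ x ∈ tp K (gp K n) (gp K j)}

variable (p : ℕ → ℕ → ℕ → FA K ⊗[K] FA K) (t n : ℕ)

theorem crossingSpan_le : crossingSpan p t n ≤ tp K (gp K n) (midGp' K t n) := by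
  refine Submodule.span_le.2 ?_
  rintro x ⟨-, j, hj, hx⟩
  exact tp_mono le_rfl (le_iSup₂_of_le (f := fun i _ => gp K i) j hj le_rfl) hx

theorem isHomog_crossingSpan : IsHomog K (crossingSpan p t n) :=
  by
  refine ⟨_, ?_, rfl⟩
  rintro x ⟨-, j, -, hx⟩
  exact ⟨n, j, hx⟩

theorem finrank_crossingSpan_lt (ht : 1 ≤ t) (hn : 2 * t < n) :
    Module.finrank K (crossingSpan p t n) < 2 ^ (4 * t + 3) * n ^ 3 * t ^ 2 := by
  have h1 : Module.finrank K (crossingSpan p t n) ≤ Fintype.card (CrossingIndex t n) := by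
    have hfin := FiniteDimensional.span_of_finite K
      (Set.finite_range (crossingElem p (t := t) (n := n)))
    exact (Submodule.finrank_mono (Submodule.span_mono fun x hx => hx.1)).trans
      (finrank_range_le_card _)
  have h2 : Fintype.card (CrossingIndex t n) ≤
      2 ^ (t + 1) * (2 ^ (t + 1) * (n * (2 ^ (t + 1) * (t * n + 1)))) := by
    simp only [Fintype.card_prod, Fintype.card_fin]
    have := (card_shortWord_lt t).le
    gcongr
  have h3 : t * n + 1 < t * n * n * t := by
    have h4 : 3 ≤ n * t := (show 3 ≤ n by omega).trans (Nat.le_mul_of_pos_right n ht)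
    have h5 : t * n * 3 ≤ t * n * (n * t) := Nat.mul_le_mul_left _ h4
    have h6 : 0 < t * n := Nat.mul_pos ht (by omega)
    rw [mul_assoc (t * n)]
    omega
  refine (h1.trans h2).trans_lt ?_
  calc 2 ^ (t + 1) * (2 ^ (t + 1) * (n * (2 ^ (t + 1) * (t * n + 1))))
      = 2 ^ (3 * t + 3) * n * (t * n + 1) := by ring
    _ < 2 ^ (3 * t + 3) * n * (t * n * n * t) := by
      have : 0 < n := by omega
      gcongr
    _ ≤ 2 ^ (4 * t + 3) * n * (t * n * n * t) := by
      gcongr <;> omega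
    _ = 2 ^ (4 * t + 3) * n ^ 3 * t ^ 2 := by ring

variable {p t n}

theorem mul_tp_gp_one_le_crossingSpan (hp : ∀ k s r, p k s r ∈ tp K (gp K s) (gp K r))
    {u v : List (Fin 2)} (hu : u.length ≤ t) (hv : v.length ≤ t) {k s r e : ℕ} (hk : k < n)
    (hr : r ≤ t * n) (he : e ≤ t) (hs : u.length + s + e = n) (hnr : n ≤ 2 * t * r + t) :
    Submodule.span K {wordProd K u ⊗ₜ[K] wordProd K v * p k s r} * tp K (gp K e) 1 ≤
      crossingSpan p t n := by
  refine (mul_le_mul_right (tp_gp_one_le_span e) _).trans ?_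
  rw [Submodule.span_mul_span, Submodule.span_le]
  rintro _ ⟨_, rfl, _, ⟨w, hw, rfl⟩, rfl⟩
  refine Submodule.subset_span ⟨?_, v.length + r, ⟨?_, ?_⟩, ?_⟩
  · obtain ⟨u', rfl⟩ := exists_shortWord u hu
    obtain ⟨v', rfl⟩ := exists_shortWord v hv
    obtain ⟨w', rfl⟩ := exists_shortWord w (hw.trans_le he)
    refine ⟨(u', v', ⟨k, hk⟩, w', ⟨r, by omega⟩), ?_⟩
    simp only [crossingElem]
    rw [show n - u'.toList.length - w'.toList.length = s by omega]
  · rw [mul_add]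
    omega
  · rw [mul_assoc]
    omega
  · have h1 := tp_mul_tp_le _ _ _ _ (Submodule.mul_mem_mul
      (tmul_mem_tp (wordProd_mem_gp (K := K) u) (wordProd_mem_gp v)) (hp k s r))
    have h2 := tp_mul_tp_le _ _ _ _ (Submodule.mul_mem_mul h1
      (tmul_mem_tp (wordProd_mem_gp (K := K) w) one_mem_gp_zero))
    simp only [gp_mul_gp] at h2
    rwa [hw, hs, add_zero] at h2

theorem tmul_mul_pow_mem {f : FA K ⊗[K] FA K} {c : ℕ → FA K ⊗[K] FA K} (h0 : c 0 = 0)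
    (hct : ∀ i, t < i → c i = 0) (hc : ∀ i, c i ∈ tp K (gp K i) (gpIcc K 1 t))
    (hf : f = ∑ i ∈ Finset.range (t + 1), c i)
    (hp : ∀ k s r, p k s r ∈ tp K (gp K s) (gp K r))
    (hpc : ∀ k s, powPart c k s = ∑ r ∈ Finset.Icc k (t * k), p k s r)
    (hn : 2 * t < n) {u v : List (Fin 2)} (hu : u.length ≤ t) (hv : v.length ≤ t) {m : ℕ}
    (hm : n < m) :
    wordProd K u ⊗ₜ[K] wordProd K v * f ^ m ∈
      crossingSpan p t n * Hsp K t * Submodule.span K {f ^ (m - n)} * ⊤ := by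
  refine mul_pow_mem_of_crossing h0 hct hf (Submodule.toAddSubmonoid _) _
    (N := n - u.length) (by omega) (by omega) fun k hk s hs i hi hit => ?_
  rw [Submodule.mem_toAddSubmonoid]
  rcases lt_or_ge (t * k) s with hks | hks
  · simp [powPart_eq_zero_of_gt hct hks]
  have hk1 : 1 ≤ k := by
    by_contra! h
    rw [show k = 0 by omega] at hks
    omega
  rw [hpc, show m - (k + 1) = (m - n) + (n - (k + 1)) by omega, pow_add, ← mul_assoc]
  refine Submodule.mul_mem_mul (Submodule.mul_mem_mul ?_ (Submodule.mem_span_singleton_self _))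
    Submodule.mem_top
  simp only [Finset.mul_sum, Finset.sum_mul]
  refine sum_mem fun r hr => ?_
  rw [Finset.mem_Icc] at hr
  have htr : t * k ≤ t * r := Nat.mul_le_mul_left t hr.1
  have htk : t * 1 ≤ t * k := Nat.mul_le_mul_left t hk1
  have htn : t * k ≤ t * n := Nat.mul_le_mul_left t (by omega)
  set e := n - u.length - s with he
  have hci : c i ∈ tp K (gp K e) 1 * tp K (gp K (i - e)) (gpIcc K 1 t) := by
    refine tp_mul_le _ _ _ ?_
    rw [gp_mul_gp, show e + (i - e) = i by omega]
    exact hc i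
  refine mul_mem_mul_of_span_singleton_mul_le
    (mul_tp_gp_one_le_crossingSpan hp hu hv ?_ ?_ ?_ ?_ ?_) (tp_gpIcc_le_Hsp ?_ le_rfl) hci
  any_goals omega
  rw [mul_assoc]
  omega

end CrossingSpace

theorem statement12 (K : Type) [Field K] (t : ℕ) (ht : 1 ≤ t)
    (f : FA K ⊗[K] FA K)
    (hf : f ∈ ⨆ i ∈ Finset.Icc 1 t, ⨆ j ∈ Finset.Icc 1 t, tp K (gp K i) (gp K j))
    (n : ℕ) (hn : 2 * t < n) :
    ∃ T : Submodule K (FA K ⊗[K] FA K),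
      T ≤ tp K (gp K n) (midGp' K t n) ∧
      IsHomog K T ∧
      Module.finrank K T < 2 ^ (4 * t + 3) * n ^ 3 * t ^ 2 ∧
      ∀ m : ℕ, n < m →
        Hsp K t * Submodule.span K {f ^ m} ≤
          T * Hsp K t * Submodule.span K {f ^ (m - n)} * ⊤ ∧
        f ^ m ∈ T * Hsp K t * Submodule.span K {f ^ (m - n)} * ⊤ := by
  obtain ⟨c, h0, hct, hc, hfc⟩ := exists_left_components hf
  obtain ⟨p, hp, hpc⟩ := exists_powPart_components hc
  refine ⟨crossingSpan p t n, crossingSpan_le p t n, isHomog_crossingSpan p t n,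
    finrank_crossingSpan_lt p t n ht hn, fun m hm => ?_⟩
  have key : Hsp K t * Submodule.span K {f ^ m} ≤
      crossingSpan p t n * Hsp K t * Submodule.span K {f ^ (m - n)} * ⊤ := by
    simp only [Hsp, Submodule.iSup_mul]
    refine iSup₂_le fun i hi => iSup₂_le fun j hj => ?_
    rw [Finset.mem_Iic] at hi hj
    rw [tp_gp_eq_span, Submodule.span_mul_span, Submodule.span_le]
    rintro _ ⟨_, ⟨u, v, rfl, rfl, rfl⟩, _, rfl, rfl⟩
    exact tmul_mul_pow_mem h0 hct hc hfc hp hpc hn hi hj hm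
  refine ⟨key, key ?_⟩
  have h1 : (1 : FA K ⊗[K] FA K) ∈ Hsp K t :=
    tp_gp_le_Hsp (Nat.zero_le t) (Nat.zero_le t) (tmul_mem_tp one_mem_gp_zero one_mem_gp_zero)
  simpa using Submodule.mul_mem_mul h1 (Submodule.mem_span_singleton_self (R := K) (f ^ m))
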